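/- Let N_r, N_t ≥ 1, let C ⊆ ℂ be a finite nonempty constellation, and let H ∈ Matrix (Fin N_r) (Fin N_t) ℂ admit a factorization H = Q·R with Qᴴ·Q = 1 (Q has orthonormal columns) and R ∈ Matrix (Fin N_t) (Fin N_t) ℂ. Then for every y ∈ ℂ^{N_r}, the set of vectors x ∈ C^{N_t} minimizing ‖y − H·x‖ over C^{N_t} equals the set of vectors x ∈ C^{N_t} minimizing ‖Qᴴ·y − R·x‖ over C^{N_t}. That is, hard maximum-likelihood detection is invariant under replacing (y, H) by (Qᴴ·y, R). -/

import Mathlib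

/-- View a plain complex vector as an element of `EuclideanSpace ℂ (Fin n)`
(so that `‖·‖` is the standard Hermitian / ℓ² norm). -/
noncomputable def toE {n : ℕ} (v : Fin n → ℂ) : EuclideanSpace ℂ (Fin n) :=
  (WithLp.equiv 2 (Fin n → ℂ)).symm v

/-- The squared Euclidean norm, seen in `ℂ`, is the Hermitian product of a vector with itself. -/
lemma norm_toE_sq {n : ℕ} (v : Fin n → ℂ) : ((‖toE v‖ ^ 2 : ℝ) : ℂ) = star v ⬝ᵥ v := by
  simp [EuclideanSpace.norm_sq_eq, toE, dotProduct, Complex.conj_mul']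

/-- Pythagoras for a matrix with orthonormal columns: the part of the residual orthogonal to the
column space does not depend on `v`. -/
lemma norm_toE_sub_mulVec_sq {m n : ℕ} {Q : Matrix (Fin m) (Fin n) ℂ}
    (hQ : Q.conjTranspose * Q = 1) (y : Fin m → ℂ) (v : Fin n → ℂ) :
    ‖toE y - toE (Q.mulVec v)‖ ^ 2 = ‖toE (Q.conjTranspose.mulVec y) - toE v‖ ^ 2
      + (‖toE y‖ ^ 2 - ‖toE (Q.conjTranspose.mulVec y)‖ ^ 2) := by
  have toE_sub {k : ℕ} (a b : Fin k → ℂ) : toE a - toE b = toE (a - b) := rfl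
  have cross : star y ⬝ᵥ Q.mulVec v = star (Q.conjTranspose.mulVec y) ⬝ᵥ v := by
    rw [Matrix.star_mulVec, Matrix.conjTranspose_conjTranspose, Matrix.dotProduct_mulVec]
  have cross' : star (Q.mulVec v) ⬝ᵥ y = star v ⬝ᵥ Q.conjTranspose.mulVec y := by
    rw [Matrix.star_mulVec, Matrix.dotProduct_mulVec]
  have isom : star (Q.mulVec v) ⬝ᵥ Q.mulVec v = star v ⬝ᵥ v := by
    rw [Matrix.star_mulVec, ← Matrix.dotProduct_mulVec, Matrix.mulVec_mulVec, hQ,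
      Matrix.one_mulVec]
  apply Complex.ofReal_injective
  rw [toE_sub, toE_sub, Complex.ofReal_add, Complex.ofReal_sub]
  simp only [norm_toE_sq, star_sub, sub_dotProduct, dotProduct_sub, cross, cross', isom]
  ring

/-- **Invariance of hard maximum-likelihood detection under a QR-type factorization.**
If `H = Q R` with `Qᴴ Q = 1` (orthonormal columns), then for every `y ∈ ℂ^{Nr}`, the set of
vectors `x ∈ C^{Nt}` minimizing `‖y - H x‖` over `C^{Nt}` equals the set of vectors
minimizing `‖Qᴴ y - R x‖` over `C^{Nt}`. -/
theorem hard_ml_qr_invariant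
    (Nr Nt : ℕ) (hNr : 1 ≤ Nr) (hNt : 1 ≤ Nt)
    (C : Finset ℂ) (hC : C.Nonempty)
    (H : Matrix (Fin Nr) (Fin Nt) ℂ)
    (Q : Matrix (Fin Nr) (Fin Nt) ℂ) (R : Matrix (Fin Nt) (Fin Nt) ℂ)
    (hH : H = Q * R) (hQ : Q.conjTranspose * Q = 1)
    (y : Fin Nr → ℂ) :
    (Fintype.piFinset fun _ : Fin Nt => C).filter
        (fun x => ∀ z ∈ Fintype.piFinset fun _ : Fin Nt => C,
          ‖toE y - toE (H.mulVec x)‖ ≤ ‖toE y - toE (H.mulVec z)‖) =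
      (Fintype.piFinset fun _ : Fin Nt => C).filter
        (fun x => ∀ z ∈ Fintype.piFinset fun _ : Fin Nt => C,
          ‖toE (Q.conjTranspose.mulVec y) - toE (R.mulVec x)‖ ≤
            ‖toE (Q.conjTranspose.mulVec y) - toE (R.mulVec z)‖) := by
  subst hH
  have key (x z : Fin Nt → ℂ) :
      ‖toE y - toE ((Q * R).mulVec x)‖ ≤ ‖toE y - toE ((Q * R).mulVec z)‖ ↔
        ‖toE (Q.conjTranspose.mulVec y) - toE (R.mulVec x)‖ ≤
          ‖toE (Q.conjTranspose.mulVec y) - toE (R.mulVec z)‖ := by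
    rw [← sq_le_sq₀ (norm_nonneg _) (norm_nonneg _), ← Matrix.mulVec_mulVec,
      ← Matrix.mulVec_mulVec, norm_toE_sub_mulVec_sq hQ, norm_toE_sub_mulVec_sq hQ,
      add_le_add_iff_right, sq_le_sq₀ (norm_nonneg _) (norm_nonneg _)]
  simp only [key]
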